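/- Characterization of transitions and final states in transition-maximal NFAs: let N be a relational NFA over Σ with state set Z and L := L(N). An NFA M on the same state set Z extends N if I_N ⊆ I_M, F_N ⊆ F_M, N_a ⊆ M_a for every letter a, and L(M) = L(N); N is transition-maximal if its only extension is itself. If N is transition-maximal then: (T) for every letter a and states z₁, z₂: (z₁,z₂) ∈ N_a if and only if for every word u, L(N_{@z₁}) ⊆ u⁻¹L implies L(N_{@z₂}) ⊆ (u++[a])⁻¹L; and (F) for every state z: z ∈ F_N if and only if for every word u, L(N_{@z}) ⊆ u⁻¹L implies u ∈ L. -/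

import Mathlib

/-- A relational nondeterministic finite automaton over alphabet `σ` with states `Z`. -/
structure RelNFA (σ : Type*) (Z : Type*) where
  /-- initial states -/
  I : Set Z
  /-- final states -/
  F : Set Z
  /-- for each letter, a transition relation -/
  tr : σ → Z → Z → Prop

namespace RelNFA

variable {σ Z : Type*}

/-- `N_w`: the transition relation of the word `w`, with `N_ε` the identity
relation and `N_{u·a} = N_u ; N_a`. -/
def runRel (N : RelNFA σ Z) (w : List σ) : Z → Z → Prop :=
  w.foldl (fun R a => fun z z' => ∃ y, R z y ∧ N.tr a y z') Eq

/-- `N_w[S]`: the relational image of a set of states. -/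
def imgSet (N : RelNFA σ Z) (w : List σ) (S : Set Z) : Set Z :=
  {z' | ∃ z ∈ S, N.runRel w z z'}

/-- The language accepted by `N`: `{w : N_w[I] ∩ F ≠ ∅}`. -/
def lang (N : RelNFA σ Z) : Set (List σ) :=
  {w | (N.imgSet w N.I ∩ N.F).Nonempty}

/-- `L(N_{@z})`: the language accepted by `N` with initial states `{z}`. -/
def langFrom (N : RelNFA σ Z) (z : Z) : Set (List σ) :=
  {w | (N.imgSet w {z} ∩ N.F).Nonempty}

/-- The reverse nfa: swap initial and final states and take converse transitions. -/
def rev (N : RelNFA σ Z) : RelNFA σ Z where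
  I := N.F
  F := N.I
  tr := fun a z z' => N.tr a z' z

end RelNFA

/-- Left quotient of a language by a single word: `u⁻¹L = {w : u++w ∈ L}`. -/
def leftQuot {σ : Type*} (u : List σ) (L : Set (List σ)) : Set (List σ) :=
  {w | u ++ w ∈ L}

/-- `M` extends `N`: same state set, more initial/final states and transitions,
same accepted language. -/
def ExtendsNFA {σ Z : Type*} (M N : RelNFA σ Z) : Prop :=
  N.I ⊆ M.I ∧ N.F ⊆ M.F ∧ (∀ (a : σ) (z z' : Z), N.tr a z z' → M.tr a z z') ∧
    M.lang = N.lang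

/-- An nfa is transition-maximal if its only extension is itself. -/
def TransitionMaximal {σ Z : Type*} (N : RelNFA σ Z) : Prop :=
  ∀ M : RelNFA σ Z, ExtendsNFA M N → M = N

namespace RelNFA

variable {σ Z : Type*}

theorem runRel_nil (N : RelNFA σ Z) (z z' : Z) : N.runRel [] z z' ↔ z = z' := Iff.rfl

theorem runRel_concat (N : RelNFA σ Z) (w : List σ) (a : σ) (z z' : Z) :
    N.runRel (w ++ [a]) z z' ↔ ∃ y, N.runRel w z y ∧ N.tr a y z' := by
  simp [runRel, List.foldl_append]

theorem runRel_cons (N : RelNFA σ Z) {a : σ} {w : List σ} {z₁ z₂ z₃ : Z}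
    (ha : N.tr a z₁ z₂) (hw : N.runRel w z₂ z₃) : N.runRel (a :: w) z₁ z₃ := by
  induction w using List.reverseRecOn generalizing z₃ with
  | nil =>
    obtain rfl := (N.runRel_nil _ _).1 hw
    exact (N.runRel_concat [] a _ _).2 ⟨z₁, rfl, ha⟩
  | append_singleton w b ih =>
    obtain ⟨y, hy, hb⟩ := (N.runRel_concat w b _ _).1 hw
    exact (N.runRel_concat (a :: w) b _ _).2 ⟨y, ih hy, hb⟩

theorem runRel_mono {N M : RelNFA σ Z} (h : ∀ a z z', N.tr a z z' → M.tr a z z')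
    {w : List σ} {z z' : Z} (hw : N.runRel w z z') : M.runRel w z z' := by
  induction w using List.reverseRecOn generalizing z' with
  | nil => exact hw
  | append_singleton w b ih =>
    obtain ⟨y, hy, hb⟩ := (N.runRel_concat w b _ _).1 hw
    exact (M.runRel_concat w b _ _).2 ⟨y, ih hy, h _ _ _ hb⟩

theorem mem_lang {N : RelNFA σ Z} {w : List σ} :
    w ∈ N.lang ↔ ∃ z ∈ N.I, ∃ z' ∈ N.F, N.runRel w z z' := by
  constructor
  · rintro ⟨z', ⟨z, hz, hw⟩, hz'⟩
    exact ⟨z, hz, z', hz', hw⟩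
  · rintro ⟨z, hz, z', hz', hw⟩
    exact ⟨z', ⟨z, hz, hw⟩, hz'⟩

theorem mem_langFrom {N : RelNFA σ Z} {w : List σ} {z : Z} :
    w ∈ N.langFrom z ↔ ∃ z' ∈ N.F, N.runRel w z z' := by
  constructor
  · rintro ⟨z', ⟨_, rfl, hw⟩, hz'⟩
    exact ⟨z', hz', hw⟩
  · rintro ⟨z', hz', hw⟩
    exact ⟨z', ⟨z, rfl, hw⟩, hz'⟩

/-- The nfa on the states of `N` whose transitions and final states are those permitted by
the left word quotients of the language of `N`. -/
def quotientSaturation (N : RelNFA σ Z) : RelNFA σ Z where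
  I := N.I
  F := {z | ∀ u : List σ, N.langFrom z ⊆ leftQuot u N.lang → u ∈ N.lang}
  tr := fun a z₁ z₂ => ∀ u : List σ, N.langFrom z₁ ⊆ leftQuot u N.lang →
    N.langFrom z₂ ⊆ leftQuot (u ++ [a]) N.lang

theorem langFrom_subset_of_runRel_quotientSaturation (N : RelNFA σ Z) {w : List σ} {z z' : Z}
    (hz : N.langFrom z ⊆ N.lang) (hw : N.quotientSaturation.runRel w z z') :
    N.langFrom z' ⊆ leftQuot w N.lang := by
  induction w using List.reverseRecOn generalizing z' with
  | nil =>
    obtain rfl := (runRel_nil _ _ _).1 hw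
    exact hz
  | append_singleton w b ih =>
    obtain ⟨y, hy, hb⟩ := (runRel_concat _ w b _ _).1 hw
    exact hb w (ih hy)

theorem quotientSaturation_extends (N : RelNFA σ Z) : ExtendsNFA N.quotientSaturation N := by
  have hF : N.F ⊆ N.quotientSaturation.F := fun z hz u hu => by
    simpa [leftQuot] using hu (mem_langFrom.2 ⟨z, hz, rfl⟩ : [] ∈ N.langFrom z)
  have htr : ∀ a z z', N.tr a z z' → N.quotientSaturation.tr a z z' := by
    intro a z₁ z₂ ha u hu w hw
    obtain ⟨z₃, hz₃, hw⟩ := mem_langFrom.1 hw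
    simpa [leftQuot] using hu (mem_langFrom.2 ⟨z₃, hz₃, N.runRel_cons ha hw⟩)
  refine ⟨subset_rfl, hF, htr, Set.Subset.antisymm ?_ ?_⟩
  · intro w hw
    obtain ⟨z, hz, z', hz', hw⟩ := mem_lang.1 hw
    refine hz' w (N.langFrom_subset_of_runRel_quotientSaturation (fun v hv => ?_) hw)
    obtain ⟨y, hy, hv⟩ := mem_langFrom.1 hv
    exact mem_lang.2 ⟨z, hz, y, hy, hv⟩
  · intro w hw
    obtain ⟨z, hz, z', hz', hw⟩ := mem_lang.1 hw
    exact mem_lang.2 ⟨z, hz, z', hF hz', runRel_mono htr hw⟩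

end RelNFA

/-- In a transition-maximal nfa, transitions and final states are characterised by
the left word quotients of the accepted language `L`:
(T) `(z₁,z₂) ∈ N_a` iff for every word `u`, `L(N_{@z₁}) ⊆ u⁻¹L` implies
`L(N_{@z₂}) ⊆ (u++[a])⁻¹L`; and
(F) `z ∈ F_N` iff for every word `u`, `L(N_{@z}) ⊆ u⁻¹L` implies `u ∈ L`. -/
theorem transitionMaximal_characterisation {σ Z : Type*} (N : RelNFA σ Z)
    (h : TransitionMaximal N) :
    (∀ (a : σ) (z₁ z₂ : Z), N.tr a z₁ z₂ ↔
      ∀ u : List σ, N.langFrom z₁ ⊆ leftQuot u N.lang →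
        N.langFrom z₂ ⊆ leftQuot (u ++ [a]) N.lang) ∧
    (∀ z : Z, z ∈ N.F ↔
      ∀ u : List σ, N.langFrom z ⊆ leftQuot u N.lang → u ∈ N.lang) := by
  have hN := h _ N.quotientSaturation_extends
  constructor
  · intro a z₁ z₂
    exact iff_of_eq (congrArg (fun M : RelNFA σ Z => M.tr a z₁ z₂) hN.symm)
  · intro z
    exact iff_of_eq (congrArg (fun M : RelNFA σ Z => z ∈ M.F) hN.symm)
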